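/- Let S ⊆ ℝ² satisfy (H1), let r ∈ (0, r_S), let p ∈ S, and assume S ≠ {p}. If C_r(p) contains a nontrivial arc of the circle ∂B_r(p), then C_r(p) is a single connected closed arc of ∂B_r(p) of length at most πr. -/

import Mathlib

open Metric Set Real
open scoped RealInnerProductSpace

noncomputable section

abbrev E2 := EuclideanSpace ℝ (Fin 2)

/-- The contact set `C_r(p) = ∂B_r(p) ∩ ∂S_r = {y ∈ ∂S_r : |y − p| = r}`. -/
def contactSet (S : Set E2) (r : ℝ) (p : E2) : Set E2 :=
  Metric.sphere p r ∩ frontier {x | infDist x S < r}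

/-- `A` is a closed arc of the circle `∂B_r(p)` of length `L`: in a suitable orthonormal
frame `(u, v)`, it is the image of the angular interval `[0, L/r]` under the standard
parametrization of `∂B_r(p)`. -/
def IsClosedArc (p : E2) (r : ℝ) (A : Set E2) (L : ℝ) : Prop :=
  ∃ u v : E2, ‖u‖ = 1 ∧ ‖v‖ = 1 ∧ ⟪u, v⟫ = 0 ∧
    A = (fun θ : ℝ => p + (r * Real.cos θ) • u + (r * Real.sin θ) • v) '' Set.Icc 0 (L / r)

/-- A point at positive distance from a closed set has distance exactly `r` iff it lies on the
boundary of the open `r`-tubular neighborhood. -/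
theorem frontier_infDist_lt {S : Set E2} (hne : S.Nonempty) (hcl : IsClosed S) {r : ℝ}
    (hr : 0 < r) : frontier {x | infDist x S < r} = {x | infDist x S = r} := by
  have hcont : Continuous (fun x : E2 => infDist x S) := continuous_infDist_pt S
  refine (frontier_lt_subset_eq hcont continuous_const).antisymm ?_
  intro y (hy : infDist y S = r)
  rw [(isOpen_lt hcont continuous_const).frontier_eq]
  refine ⟨?_, by simp [hy]⟩
  obtain ⟨z, hz, hyz⟩ := hcl.exists_infDist_eq_dist hne y
  have hline : Continuous (fun t : ℝ => y + t • (z - y)) := by fun_prop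
  have ht : Filter.Tendsto (fun t : ℝ => y + t • (z - y)) (nhdsWithin 0 (Ioi 0)) (nhds y) := by
    have := (hline.tendsto 0).mono_left (nhdsWithin_le_nhds (s := Ioi (0 : ℝ)))
    simpa using this
  refine mem_closure_of_tendsto ht ?_
  filter_upwards [Ioo_mem_nhdsGT (zero_lt_one (α := ℝ))] with t ht
  have h1 : dist (y + t • (z - y)) z = (1 - t) * dist y z := by
    have : y + t • (z - y) - z = (1 - t) • (y - z) := by module
    rw [dist_eq_norm, dist_eq_norm, this, norm_smul, Real.norm_of_nonneg (by linarith [ht.2])]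
  have h2 := infDist_le_dist_of_mem (x := y + t • (z - y)) hz
  rw [h1, ← hyz, hy] at h2
  show infDist _ S < r
  nlinarith [ht.1]

/-- Where the distance function to a closed set is differentiable and positive, it grows at unit
rate in the direction pointing away from a nearest point. -/
theorem exists_unit_hasDerivAt_infDist {S : Set E2} (hne : S.Nonempty) (hcl : IsClosed S) {y : E2}
    (hy : 0 < infDist y S) (hd : DifferentiableAt ℝ (fun x => infDist x S) y) :
    ∃ e : E2, ‖e‖ = 1 ∧ HasDerivAt (fun t : ℝ => infDist (y + t • e) S) 1 0 := by
  obtain ⟨z, hz, hyz⟩ := hcl.exists_infDist_eq_dist hne y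
  set D := infDist y S with hD
  have hDn : ‖y - z‖ = D := by rw [hyz, dist_eq_norm]
  set e : E2 := D⁻¹ • (y - z) with he
  have hen : ‖e‖ = 1 := by
    rw [he, norm_smul, hDn, norm_inv, Real.norm_of_nonneg hy.le, inv_mul_cancel₀ hy.ne']
  have hDe : y - z = D • e := by rw [he, smul_smul, mul_inv_cancel₀ hy.ne', one_smul]
  refine ⟨e, hen, ?_⟩
  have hder : HasDerivAt (fun t : ℝ => infDist (y + t • e) S)
      (fderiv ℝ (fun x => infDist x S) y e) 0 := by
    have h1 : HasDerivAt (fun t : ℝ => y + t • e) e 0 := by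
      simpa using ((hasDerivAt_id (0 : ℝ)).smul_const e).const_add y
    have h2 : HasFDerivAt (fun x => infDist x S) (fderiv ℝ (fun x => infDist x S) y)
        (y + (0 : ℝ) • e) := by simpa using hd.hasFDerivAt
    exact h2.comp_hasDerivAt (0 : ℝ) h1
  have hval : ∀ t ∈ Icc (-D) 0, infDist (y + t • e) S = D + t := by
    intro t ht
    apply le_antisymm
    · refine (infDist_le_dist_of_mem hz).trans_eq ?_
      have : y + t • e - z = (D + t) • e := by
        rw [add_smul, ← hDe]; abel
      rw [dist_eq_norm, this, norm_smul, hen, mul_one, Real.norm_of_nonneg (by linarith [ht.1])]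
    · have h3 := infDist_le_infDist_add_dist (x := y) (y := y + t • e) (s := S)
      have : dist y (y + t • e) = -t := by
        rw [dist_self_add_right, norm_smul, hen, mul_one, Real.norm_of_nonpos ht.2]
      rw [this] at h3
      linarith
  have hlin : HasDerivWithinAt (fun t : ℝ => infDist (y + t • e) S) 1 (Icc (-D) 0) 0 := by
    have : HasDerivWithinAt (fun t : ℝ => D + t) 1 (Icc (-D) 0) 0 :=
      ((hasDerivAt_id (0 : ℝ)).const_add D).hasDerivWithinAt
    exact this.congr hval (hval 0 ⟨by linarith, le_rfl⟩)
  have hu : UniqueDiffWithinAt ℝ (Icc (-D) 0) 0 :=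
    uniqueDiffOn_Icc (by linarith) 0 ⟨by linarith, le_rfl⟩
  have := hu.eq_deriv _ hder.hasDerivWithinAt hlin
  rwa [this] at hder

/-- If the distance function is differentiable at all points of distance in `(0, d(x) + h)`, then
its maximal possible growth `h` is attained on the sphere of radius `h` around `x`. -/
theorem exists_infDist_eq_add {S : Set E2} (hne : S.Nonempty) (hcl : IsClosed S) {x : E2} {h : ℝ}
    (hx : 0 < infDist x S) (hh : 0 < h)
    (hd : ∀ y, 0 < infDist y S → infDist y S < infDist x S + h →
      DifferentiableAt ℝ (fun z => infDist z S) y) :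
    ∃ y, dist y x = h ∧ infDist x S + h ≤ infDist y S := by
  have hcont : Continuous (fun x : E2 => infDist x S) := continuous_infDist_pt S
  have key : ∀ η ∈ Ioo (0 : ℝ) 1, ∃ y ∈ sphere x h, infDist x S + (1 - η) * h ≤ infDist y S := by
    intro η hη
    obtain ⟨y, hyb, hmax⟩ := (isCompact_closedBall x h).exists_isMaxOn
      (f := fun y => infDist y S - (1 - η) * dist y x) ⟨x, mem_closedBall_self hh.le⟩
      (by fun_prop)
    have hyx := hmax (mem_closedBall_self hh.le)
    simp only [mem_ofPred_eq, dist_self, mul_zero, sub_zero] at hyx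
    rw [mem_closedBall] at hyb
    rcases hyb.eq_or_lt with hyh | hyh
    · exact ⟨y, hyh, by rw [hyh] at hyx; linarith⟩
    exfalso
    have hy0 : 0 < infDist y S := by
      have : 0 ≤ (1 - η) * dist y x := mul_nonneg (by linarith [hη.2]) dist_nonneg
      linarith
    have hy1 : infDist y S < infDist x S + h := by
      have := infDist_le_infDist_add_dist (x := y) (y := x) (s := S)
      linarith
    obtain ⟨e, he, hder⟩ := exists_unit_hasDerivAt_infDist hne hcl hy0 (hd y hy0 hy1)
    have hsub : Ioi (0 : ℝ) ⊆ {0}ᶜ := fun t ht => (mem_Ioi.1 ht).ne'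
    have hslope := (hasDerivAt_iff_tendsto_slope_zero.1 hder).mono_left (nhdsWithin_mono 0 hsub)
    have hev := hslope.eventually (lt_mem_nhds (show 1 - η < 1 by linarith [hη.1]))
    have hev2 := Ioo_mem_nhdsGT (show (0 : ℝ) < h - dist y x by linarith)
    obtain ⟨t, ht1, ht2⟩ := (hev.and hev2).exists
    simp only [zero_add, zero_smul, add_zero, smul_eq_mul] at ht1
    have hdt : dist (y + t • e) y = t := by
      rw [dist_self_add_left, norm_smul, he, mul_one, Real.norm_of_nonneg ht2.1.le]
    have htri : dist (y + t • e) x ≤ t + dist y x := by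
      simpa [hdt] using dist_triangle (y + t • e) y x
    have hm := hmax (show y + t • e ∈ closedBall x h by
      rw [mem_closedBall]; linarith [ht2.2])
    simp only [mem_ofPred_eq] at hm
    rw [inv_mul_eq_div, lt_div_iff₀ ht2.1] at ht1
    have := mul_le_mul_of_nonneg_left htri (show 0 ≤ 1 - η by linarith [hη.2])
    linarith
  obtain ⟨y₁, hy₁, -⟩ := key (1 / 2) (by norm_num)
  obtain ⟨y, hy, hmax⟩ := (isCompact_sphere x h).exists_isMaxOn ⟨y₁, hy₁⟩ hcont.continuousOn
  refine ⟨y, hy, le_of_forall_pos_lt_add fun ε hε => ?_⟩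
  obtain ⟨η, hη0, hη1⟩ := exists_between (show 0 < min 1 (ε / h) by positivity)
  obtain ⟨z, hz, hzd⟩ := key η ⟨hη0, hη1.trans_le (min_le_left _ _)⟩
  have h1 : infDist z S ≤ infDist y S := hmax hz
  have h2 := hη1.trans_le (min_le_right _ _)
  rw [lt_div_iff₀ hh] at h2
  linarith

/-- The distance from `p + ρ n` to `S ∋ p` is `ρ` iff the open ball `B_ρ(p + ρ n)` misses `S`. -/
theorem infDist_add_smul_eq_iff {S : Set E2} {p : E2} (hp : p ∈ S) {n : E2} (hn : ‖n‖ = 1) {ρ : ℝ}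
    (hρ : 0 < ρ) :
    infDist (p + ρ • n) S = ρ ↔ ∀ s ∈ S, 2 * ρ * ⟪s - p, n⟫ ≤ ‖s - p‖ ^ 2 := by
  have hle : infDist (p + ρ • n) S ≤ ρ := by
    refine (infDist_le_dist_of_mem hp).trans_eq ?_
    rw [dist_self_add_left, norm_smul, hn, mul_one, Real.norm_of_nonneg hρ.le]
  have hexp : ∀ s, ‖s - p - ρ • n‖ ^ 2 = ‖s - p‖ ^ 2 - 2 * ρ * ⟪s - p, n⟫ + ρ ^ 2 := by
    intro s
    rw [norm_sub_sq_real, inner_smul_right, norm_smul, hn, mul_one, Real.norm_of_nonneg hρ.le]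
    ring
  have hiff : ∀ s, ρ ≤ dist (p + ρ • n) s ↔ 2 * ρ * ⟪s - p, n⟫ ≤ ‖s - p‖ ^ 2 := by
    intro s
    rw [dist_comm, dist_eq_norm, ← sub_sub, ← sq_le_sq₀ hρ.le (norm_nonneg _), hexp]
    constructor <;> intro h <;> linarith
  constructor
  · intro h s hs
    rw [← hiff, ← h]
    simpa [h] using infDist_le_dist_of_mem (x := p + ρ • n) hs
  · intro h
    exact hle.antisymm ((le_infDist ⟨p, hp⟩).2 fun {s} hs => (hiff s).2 (h s hs))

/-- Inside the tube where the distance function is differentiable, a normal segment at `p` extends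
to the full tube radius. -/
theorem infDist_add_smul_extend {S : Set E2} (hcl : IsClosed S) {rS : ℝ}
    (hd : ∀ y, 0 < infDist y S → infDist y S < rS → DifferentiableAt ℝ (fun z => infDist z S) y)
    {p : E2} (hp : p ∈ S) {n : E2} (hn : ‖n‖ = 1) {ρ r : ℝ} (hρ : 0 < ρ) (hρr : ρ ≤ r)
    (hr : r < rS) (h : infDist (p + ρ • n) S = ρ) : infDist (p + r • n) S = r := by
  rcases hρr.eq_or_lt with rfl | hlt
  · exact h
  obtain ⟨y, hyd, hy⟩ := exists_infDist_eq_add ⟨p, hp⟩ hcl (x := p + ρ • n) (h := r - ρ)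
    (by rwa [h]) (by linarith) (fun y h0 h1 => hd y h0 (by rw [h] at h1; linarith))
  rw [h, add_sub_cancel] at hy
  have hyp : r ≤ ‖y - p‖ := by
    rw [← dist_eq_norm]; exact hy.trans (infDist_le_dist_of_mem hp)
  have hw : ‖y - (p + ρ • n)‖ = r - ρ := by rw [← dist_eq_norm, hyd]
  set w := y - (p + ρ • n) with hwdef
  have hsum : y - p = w + ρ • n := by rw [hwdef]; abel
  have hinner : r - ρ ≤ ⟪w, n⟫ := by
    have h1 : ‖w + ρ • n‖ ^ 2 = (r - ρ) ^ 2 + 2 * (ρ * ⟪w, n⟫) + ρ ^ 2 := by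
      rw [norm_add_sq_real, hw, inner_smul_right, norm_smul, hn, mul_one,
        Real.norm_of_nonneg hρ.le]
    rw [hsum] at hyp
    have h2 : r ^ 2 ≤ ‖w + ρ • n‖ ^ 2 := pow_le_pow_left₀ (by linarith) hyp 2
    nlinarith
  have hweq : w = (r - ρ) • n := by
    have h3 : ‖w - (r - ρ) • n‖ ^ 2 ≤ 0 := by
      rw [norm_sub_sq_real, hw, inner_smul_right, norm_smul, hn, mul_one,
        Real.norm_of_nonneg (by linarith)]
      nlinarith
    have h4 : ‖w - (r - ρ) • n‖ = 0 := by
      have := sq_nonneg ‖w - (r - ρ) • n‖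
      exact pow_eq_zero_iff two_ne_zero |>.1 (le_antisymm h3 this)
    exact sub_eq_zero.1 (norm_eq_zero.1 h4)
  have hyeq : y = p + r • n := by
    have : y = p + (w + ρ • n) := by rw [← hsum]; abel
    rw [this, hweq]; module
  rw [← hyeq]
  refine le_antisymm ?_ hy
  refine (infDist_le_dist_of_mem hp).trans_eq ?_
  rw [hyeq, dist_self_add_left, norm_smul, hn, mul_one, Real.norm_of_nonneg (by linarith)]

/-- The unit normals at `p` are closed under nonnegative combinations of unit norm. -/
theorem infDist_add_smul_combination {S : Set E2} (hcl : IsClosed S) {rS : ℝ}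
    (hd : ∀ y, 0 < infDist y S → infDist y S < rS → DifferentiableAt ℝ (fun z => infDist z S) y)
    {p : E2} (hp : p ∈ S) {r : ℝ} (hr0 : 0 < r) (hr : r < rS) {m n : E2} (hm : ‖m‖ = 1)
    (hn : ‖n‖ = 1) (hmr : infDist (p + r • m) S = r) (hnr : infDist (p + r • n) S = r) {a b : ℝ}
    (ha : 0 ≤ a) (hb : 0 ≤ b) (hab : ‖a • m + b • n‖ = 1) :
    infDist (p + r • (a • m + b • n)) S = r := by
  have hsum : 1 ≤ a + b := by
    have := norm_add_le (a • m) (b • n)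
    rwa [hab, norm_smul, norm_smul, hm, hn, mul_one, mul_one, Real.norm_of_nonneg ha,
      Real.norm_of_nonneg hb] at this
  have hpos : 0 < a + b := by linarith
  have hρ : 0 < r / (a + b) := by positivity
  refine infDist_add_smul_extend hcl hd hp hab hρ (div_le_self hr0.le hsum) hr ?_
  rw [infDist_add_smul_eq_iff hp hab hρ]
  rw [infDist_add_smul_eq_iff hp hm hr0] at hmr
  rw [infDist_add_smul_eq_iff hp hn hr0] at hnr
  intro s hs
  have h1 := mul_le_mul_of_nonneg_left (hmr s hs) ha
  have h2 := mul_le_mul_of_nonneg_left (hnr s hs) hb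
  rw [inner_add_right, inner_smul_right, inner_smul_right,
    show 2 * (r / (a + b)) * (a * ⟪s - p, m⟫ + b * ⟪s - p, n⟫) =
      (2 * r * (a * ⟪s - p, m⟫ + b * ⟪s - p, n⟫)) / (a + b) by ring, div_le_iff₀ hpos]
  linarith

/-- A connected set with more than one point has, at each of its points, a unit direction in which
the tangent ball of given radius meets the set. -/
theorem exists_unit_infDist_ne {S : Set E2} (hconn : IsPreconnected S) {p : E2} (hp : p ∈ S)
    (hS : S ≠ {p}) {r : ℝ} (hr : 0 < r) : ∃ n : E2, ‖n‖ = 1 ∧ infDist (p + r • n) S ≠ r := by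
  by_contra! hall
  have hfar : ∀ s ∈ S, s ≠ p → 2 * r ≤ ‖s - p‖ := by
    intro s hs hsp
    have hpos : 0 < ‖s - p‖ := norm_pos_iff.2 (sub_ne_zero.2 hsp)
    have hunit : ‖‖s - p‖⁻¹ • (s - p)‖ = 1 := by
      rw [norm_smul, norm_inv, norm_norm, inv_mul_cancel₀ hpos.ne']
    have := (infDist_add_smul_eq_iff hp hunit hr).1 (hall _ hunit) s hs
    rw [inner_smul_right, real_inner_self_eq_norm_sq, sq, ← mul_assoc _ ‖s - p‖ ‖s - p‖,
      inv_mul_cancel₀ hpos.ne', one_mul] at this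
    exact le_of_mul_le_mul_right this hpos
  obtain ⟨s, hs, hsp⟩ : ∃ s ∈ S, s ≠ p := by
    by_contra! h
    exact hS (eq_singleton_iff_unique_mem.2 ⟨hp, h⟩)
  obtain ⟨q, hq, hqr⟩ := hconn.intermediate_value hp hs (f := fun x => ‖x - p‖) (by fun_prop)
    (show r ∈ Icc ‖p - p‖ ‖s - p‖ from
      ⟨by simpa using hr.le, by linarith [hfar s hs hsp]⟩)
  simp only at hqr
  have hqp : q ≠ p := by
    rintro rfl
    simp at hqr
    exact hr.ne hqr
  linarith [hfar q hq hqp]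

/-- Every unit vector of the plane is `cos θ u + sin θ v` in an orthonormal frame `(u, v)`. -/
theorem exists_angle {u v : E2} (hu : ‖u‖ = 1) (hv : ‖v‖ = 1) (huv : ⟪u, v⟫ = 0) {n : E2}
    (hn : ‖n‖ = 1) : ∃ θ : ℝ, n = Real.cos θ • u + Real.sin θ • v := by
  have hon : Orthonormal ℝ ![u, v] := by
    rw [orthonormal_iff_ite]
    intro i j
    fin_cases i <;> fin_cases j <;>
      simp [hu, hv, huv, real_inner_comm u v]
  let b := basisOfOrthonormalOfCardEqFinrank hon (by simp)
  have hrep : n = b.repr n 0 • u + b.repr n 1 • v := by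
    have := b.sum_repr n
    simpa [b, Fin.sum_univ_two] using this.symm
  set c := b.repr n 0
  set s := b.repr n 1
  have hcs : c ^ 2 + s ^ 2 = 1 := by
    have h1 : ‖n‖ ^ 2 = c ^ 2 + s ^ 2 := by
      conv_lhs => rw [hrep]
      rw [norm_add_sq_real, inner_smul_left, inner_smul_right, huv, norm_smul, norm_smul, hu, hv]
      simp
    rw [← h1, hn, one_pow]
  have hz : ‖(⟨c, s⟩ : ℂ)‖ = 1 := by
    rw [Complex.norm_def, Complex.normSq_mk, ← sq, ← sq, hcs, Real.sqrt_one]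
  have hz0 : (⟨c, s⟩ : ℂ) ≠ 0 := norm_ne_zero_iff.1 (by rw [hz]; exact one_ne_zero)
  refine ⟨Complex.arg ⟨c, s⟩, ?_⟩
  rw [Complex.cos_arg hz0, Complex.sin_arg, hz, div_one, div_one]
  exact hrep

/-- A closed, `2π`-periodic set of angles that contains a nontrivial interval, misses some angle,
and contains the interval between any two of its members less than `π` apart, consists within a
suitable period window of a single interval of length at most `π`. -/
theorem exists_angle_interval {T : Set ℝ} (hT : IsClosed T) (hper : ∀ θ, θ + 2 * π ∈ T ↔ θ ∈ T)
    (hconv : ∀ α ∈ T, ∀ β ∈ T, α < β → β - α < π → Icc α β ⊆ T) {δ : ℝ} (hδ : 0 < δ)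
    (hδT : Icc 0 δ ⊆ T) {θ₀ : ℝ} (hθ₀ : θ₀ ∉ T) :
    ∃ m M τ : ℝ, m < M ∧ M - m ≤ π ∧ T ∩ Ico τ (τ + 2 * π) = Icc m M := by
  have hpi := Real.pi_pos
  have h2pi := Real.two_pi_pos
  have hperz : ∀ (k : ℤ) θ, θ + k • (2 * π) ∈ T ↔ θ ∈ T := by
    have : Function.Periodic (fun θ => θ ∈ T) (2 * π) := fun θ => propext (hper θ)
    intro k θ
    exact iff_of_eq (this.zsmul k θ)
  obtain ⟨τ, ⟨hτ0, hτ1⟩, hτT⟩ : ∃ τ ∈ Ico (0 : ℝ) (0 + 2 * π), τ ∉ T := by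
    refine ⟨toIcoMod h2pi 0 θ₀, toIcoMod_mem_Ico h2pi 0 θ₀, fun h => hθ₀ ?_⟩
    rw [← toIcoMod_add_toIcoDiv_zsmul h2pi 0 θ₀]
    exact (hperz _ _).2 h
  have hτδ : δ < τ := by
    by_contra! h
    exact hτT (hδT ⟨hτ0, h⟩)
  have hτT' : τ - 2 * π ∉ T := by
    rw [← hper, sub_add_cancel]; exact hτT
  have hcompact : IsCompact (T ∩ Icc (τ - 2 * π) τ) := isCompact_Icc.inter_left hT
  have h0mem : (0 : ℝ) ∈ T ∩ Icc (τ - 2 * π) τ :=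
    ⟨hδT ⟨le_rfl, hδ.le⟩, by linarith, hτ0⟩
  have hδmem : δ ∈ T ∩ Icc (τ - 2 * π) τ := ⟨hδT ⟨hδ.le, le_rfl⟩, by linarith, hτδ.le⟩
  obtain ⟨m, ⟨hmT, hm⟩, hmin⟩ := hcompact.exists_isLeast ⟨0, h0mem⟩
  obtain ⟨M, ⟨hMT, hM⟩, hmax⟩ := hcompact.exists_isGreatest ⟨0, h0mem⟩
  have hm0 : m ≤ 0 := hmin h0mem
  have hMδ : δ ≤ M := hmax hδmem
  have hMτ : M < τ := hM.2.lt_of_ne (fun h => hτT (h ▸ hMT))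
  have hmτ : τ - 2 * π < m := hm.1.lt_of_ne (fun h => hτT' (h ▸ hmT))
  have hlen : M - m ≤ π := by
    by_contra! h
    exact hτT (hconv M hMT (m + 2 * π) ((hper m).2 hmT) (by linarith) (by linarith)
      ⟨hMτ.le, by linarith⟩)
  refine ⟨m, M, τ - 2 * π, by linarith, hlen, ?_⟩
  ext θ
  constructor
  · rintro ⟨hθT, hθ1, hθ2⟩
    have : θ ∈ T ∩ Icc (τ - 2 * π) τ := ⟨hθT, hθ1, by linarith⟩
    exact ⟨hmin this, hmax this⟩
  · rintro ⟨h1, h2⟩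
    refine ⟨?_, by linarith, by linarith⟩
    have hcT : δ / 2 ∈ T := hδT ⟨by linarith, by linarith⟩
    rcases le_total θ (δ / 2) with h | h
    · exact hconv m hmT _ hcT (by linarith) (by linarith) ⟨h1, h⟩
    · exact hconv _ hcT M hMT (by linarith) (by linarith) ⟨h, h2⟩

/-- The unit vector at angle `θ` in the frame `(u, v)`. -/
def frameVec (u v : E2) (θ : ℝ) : E2 := Real.cos θ • u + Real.sin θ • v

theorem norm_frameVec {u v : E2} (hu : ‖u‖ = 1) (hv : ‖v‖ = 1) (huv : ⟪u, v⟫ = 0) (θ : ℝ) :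
    ‖frameVec u v θ‖ = 1 := by
  have : ‖frameVec u v θ‖ ^ 2 = 1 := by
    rw [frameVec, norm_add_sq_real, inner_smul_left, inner_smul_right, huv, norm_smul, norm_smul,
      hu, hv]
    simp
  exact (pow_eq_one_iff_of_nonneg (norm_nonneg _) two_ne_zero).1 this

theorem frameVec_combination (u v : E2) {α β : ℝ} (h : Real.sin (β - α) ≠ 0) (θ : ℝ) :
    frameVec u v θ = (Real.sin (β - θ) / Real.sin (β - α)) • frameVec u v α +
      (Real.sin (θ - α) / Real.sin (β - α)) • frameVec u v β := by
  have hc : Real.sin (β - α) * Real.cos θ =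
      Real.sin (β - θ) * Real.cos α + Real.sin (θ - α) * Real.cos β := by
    simp only [Real.sin_sub]; ring
  have hs : Real.sin (β - α) * Real.sin θ =
      Real.sin (β - θ) * Real.sin α + Real.sin (θ - α) * Real.sin β := by
    simp only [Real.sin_sub]; ring
  have hc' : Real.cos θ = Real.sin (β - θ) / Real.sin (β - α) * Real.cos α +
      Real.sin (θ - α) / Real.sin (β - α) * Real.cos β := by
    field_simp; linarith
  have hs' : Real.sin θ = Real.sin (β - θ) / Real.sin (β - α) * Real.sin α +
      Real.sin (θ - α) / Real.sin (β - α) * Real.sin β := by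
    field_simp; linarith
  simp only [frameVec]
  conv_lhs => rw [hc', hs']
  module

theorem frameVec_add (u v : E2) (m θ : ℝ) :
    frameVec u v (m + θ) = frameVec (frameVec u v m) (frameVec u v (m + π / 2)) θ := by
  simp only [frameVec, Real.cos_add, Real.sin_add, Real.cos_pi_div_two, Real.sin_pi_div_two]
  module

theorem inner_frameVec_add_pi_div_two {u v : E2} (hu : ‖u‖ = 1) (hv : ‖v‖ = 1) (huv : ⟪u, v⟫ = 0)
    (m : ℝ) : ⟪frameVec u v m, frameVec u v (m + π / 2)⟫ = 0 := by
  simp only [frameVec, Real.cos_add_pi_div_two, Real.sin_add_pi_div_two, inner_add_left,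
    inner_add_right, inner_smul_left, inner_smul_right, huv, real_inner_comm u v,
    real_inner_self_eq_norm_sq, hu, hv]
  simp
  ring

/-- **Lemma.** Let `S ⊆ ℝ²` be nonempty, closed, connected, with empty interior, and
proximally `C¹` of radius `r_S > 0`; let `r ∈ (0, r_S)`, `p ∈ S`, and assume `S ≠ {p}`.
If `C_r(p)` contains a nontrivial arc of `∂B_r(p)`, then `C_r(p)` is a single connected
closed arc of `∂B_r(p)` of length at most `πr`. -/
theorem stmt13 (S : Set E2) (rS : ℝ) (hrS : 0 < rS)
    (hne : S.Nonempty) (hcl : IsClosed S) (hconn : IsConnected S)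
    (hint : interior S = ∅)
    (hprox : ContDiffOn ℝ 1 (fun x => infDist x S)
      {x | 0 < infDist x S ∧ infDist x S < rS})
    (r : ℝ) (hr : r ∈ Set.Ioo 0 rS) (p : E2) (hp : p ∈ S) (hnotsing : S ≠ {p})
    (harc : ∃ (L : ℝ) (A : Set E2), 0 < L ∧ IsClosedArc p r A L ∧ A ⊆ contactSet S r p) :
    ∃ L : ℝ, 0 < L ∧ L ≤ π * r ∧ IsClosedArc p r (contactSet S r p) L := by
  obtain ⟨hr0, hrlt⟩ := hr
  have hcont : Continuous (fun x : E2 => infDist x S) := continuous_infDist_pt S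
  have hopen : IsOpen {x : E2 | 0 < infDist x S ∧ infDist x S < rS} :=
    (isOpen_lt continuous_const hcont).inter (isOpen_lt hcont continuous_const)
  have hd : ∀ y, 0 < infDist y S → infDist y S < rS →
      DifferentiableAt ℝ (fun z => infDist z S) y := fun y h0 h1 =>
    (hprox.differentiableOn one_ne_zero).differentiableAt (hopen.mem_nhds ⟨h0, h1⟩)
  have hC : contactSet S r p = sphere p r ∩ {x | infDist x S = r} := by
    rw [contactSet, frontier_infDist_lt hne hcl hr0]
  obtain ⟨L, A, hL, ⟨u, v, hu, hv, huv, rfl⟩, hA⟩ := harc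
  have hparam : ∀ (a b : E2) (θ : ℝ), p + (r * Real.cos θ) • a + (r * Real.sin θ) • b =
      p + r • frameVec a b θ := by
    intro a b θ
    simp only [frameVec]
    module
  have hmem : ∀ θ, p + r • frameVec u v θ ∈ contactSet S r p ↔
      infDist (p + r • frameVec u v θ) S = r := by
    intro θ
    rw [hC]
    simp [norm_smul, norm_frameVec hu hv huv, abs_of_pos hr0]
  set T : Set ℝ := {θ | infDist (p + r • frameVec u v θ) S = r} with hTdef
  have hTcl : IsClosed T := isClosed_eq (by unfold frameVec; fun_prop) continuous_const
  have hperT : ∀ θ, θ + 2 * π ∈ T ↔ θ ∈ T := by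
    intro θ
    simp [hTdef, frameVec]
  have hconvT : ∀ α ∈ T, ∀ β ∈ T, α < β → β - α < π → Icc α β ⊆ T := by
    intro α hα β hβ hαβ hlt θ hθ
    have hs : 0 < Real.sin (β - α) := Real.sin_pos_of_pos_of_lt_pi (by linarith) hlt
    have hcomb := frameVec_combination u v hs.ne' θ
    have h1 : 0 ≤ Real.sin (β - θ) / Real.sin (β - α) := div_nonneg
      (Real.sin_nonneg_of_nonneg_of_le_pi (by linarith [hθ.2]) (by linarith [hθ.1])) hs.le
    have h2 : 0 ≤ Real.sin (θ - α) / Real.sin (β - α) := div_nonneg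
      (Real.sin_nonneg_of_nonneg_of_le_pi (by linarith [hθ.1]) (by linarith [hθ.2])) hs.le
    show infDist (p + r • frameVec u v θ) S = r
    rw [hcomb]
    exact infDist_add_smul_combination hcl hd hp hr0 hrlt (norm_frameVec hu hv huv α)
      (norm_frameVec hu hv huv β) hα hβ h1 h2 (by rw [← hcomb]; exact norm_frameVec hu hv huv θ)
  have hsubT : Icc 0 (L / r) ⊆ T := by
    intro θ hθ
    have := hA (mem_image_of_mem _ hθ)
    simp only [hparam] at this
    exact (hmem θ).1 this
  obtain ⟨n₀, hn₀, hn₀r⟩ := exists_unit_infDist_ne hconn.isPreconnected hp hnotsing hr0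
  obtain ⟨θ₀, rfl⟩ := exists_angle hu hv huv hn₀
  obtain ⟨m, M, τ, hmM, hlen, hwin⟩ := exists_angle_interval hTcl hperT hconvT
    (div_pos hL hr0) hsubT (θ₀ := θ₀) hn₀r
  have hpi2 := Real.two_pi_pos
  refine ⟨r * (M - m), mul_pos hr0 (by linarith),
    by rw [mul_comm]; exact mul_le_mul_of_nonneg_right hlen hr0.le,
    frameVec u v m, frameVec u v (m + π / 2), norm_frameVec hu hv huv _, norm_frameVec hu hv huv _,
    inner_frameVec_add_pi_div_two hu hv huv m, ?_⟩
  rw [mul_div_cancel_left₀ _ hr0.ne']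
  ext y
  simp only [hparam, ← frameVec_add, mem_image]
  constructor
  · intro hy
    have hy1 : ‖y - p‖ = r := by
      rw [← dist_eq_norm]; exact hy.1
    have hunit : ‖r⁻¹ • (y - p)‖ = 1 := by
      rw [norm_smul, hy1, norm_inv, Real.norm_of_nonneg hr0.le, inv_mul_cancel₀ hr0.ne']
    obtain ⟨θ, hθ⟩ := exists_angle hu hv huv hunit
    set φ := toIcoMod hpi2 τ θ with hφ
    have hφθ : frameVec u v φ = r⁻¹ • (y - p) := by
      rw [hθ, ← toIcoMod_add_toIcoDiv_zsmul hpi2 τ θ, frameVec, zsmul_eq_mul,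
        Real.cos_add_int_mul_two_pi, Real.sin_add_int_mul_two_pi]
    have hyφ : p + r • frameVec u v φ = y := by
      rw [hφθ, smul_smul, mul_inv_cancel₀ hr0.ne', one_smul, add_sub_cancel]
    have hφm : φ ∈ Icc m M := by
      rw [← hwin]
      exact ⟨(hmem φ).1 (hyφ ▸ hy), toIcoMod_mem_Ico hpi2 τ θ⟩
    exact ⟨φ - m, ⟨by linarith [hφm.1], by linarith [hφm.2]⟩, by rw [add_sub_cancel]; exact hyφ⟩
  · rintro ⟨θ, hθ, rfl⟩
    rw [hmem]
    have : m + θ ∈ T ∩ Ico τ (τ + 2 * π) := by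
      rw [hwin]
      exact ⟨by linarith [hθ.1], by linarith [hθ.2]⟩
    exact this.1
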